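/- arXiv:1705.06054 — 13 statements merged into one kernel-verified Lean document; each statement's English description precedes it below -/
import Mathlib

section
/- Discrete maximum principle for the micro–macro scheme: assume the CFL condition v_max·Δt/Δx ≤ 1, initial data satisfying 0 ≤ φ^0_i ≤ m and η^0_{i,j} = 0 for all i ∈ ℤ and j ∈ {1,…,N_v} (with m ≥ 0), and that the scheme relations (S1), (S2), (S3) hold for all n ∈ ℕ, i ∈ ℤ, j ∈ {1,…,N_v}. Then for every n ∈ ℕ, i ∈ ℤ, j ∈ {1,…,N_v}: (1) 0 ≤ φ^n_i ≤ m; (2) 0 ≤ φ^n_i + η^n_{i,j} ≤ m; (3) for every n ≥ 1, 0 ≤ E(φ^n_i, η^n_{i,j}) ≤ m. -/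
/-- An explicit upwind transport step whose Courant number is at most one preserves bounds. -/
theorem upwind_step_mem_Icc {v dt dx vmax m a b c : ℝ} (hdt : 0 < dt) (hdx : 0 < dx)
    (hv : |v| ≤ vmax) (hCFL : vmax * dt / dx ≤ 1)
    (ha : a ∈ Set.Icc 0 m) (hb : b ∈ Set.Icc 0 m) (hc : c ∈ Set.Icc 0 m) :
    b - dt * (max v 0 * ((b - a) / dx) + min v 0 * ((c - b) / dx)) ∈ Set.Icc 0 m := by
  have key : |v| * dt / dx ≤ 1 := le_trans (by gcongr) hCFL
  have hpos : 0 ≤ |v| * dt / dx := by positivity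
  rcases le_total 0 v with h | h
  · rw [max_eq_left h, min_eq_right h]
    rw [abs_of_nonneg h] at key hpos
    have hcomb := (convex_Icc (0 : ℝ) m) ha hb hpos (sub_nonneg.2 key) (by ring)
    convert hcomb using 1
    simp only [smul_eq_mul]
    ring
  · rw [max_eq_right h, min_eq_left h]
    rw [abs_of_nonpos h] at key hpos
    have hcomb := (convex_Icc (0 : ℝ) m) hc hb hpos (sub_nonneg.2 key) (by ring)
    convert hcomb using 1
    simp only [smul_eq_mul]
    ring

/-- If a weighted mean of `exp (-x j / ε)` equals one, then `x` takes both a nonpositive and a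
nonnegative value. -/
theorem exists_nonpos_and_exists_nonneg_of_mean_exp_eq_one {ι : Type*} [Fintype ι] {ε w : ℝ}
    {M x : ι → ℝ} (hε : 0 < ε) (hM : ∀ j, 0 < M j) (hMnorm : w * ∑ j, M j = 1)
    (hmean : w * ∑ j, M j * Real.exp (-(x j) / ε) = 1) :
    (∃ j, x j ≤ 0) ∧ ∃ j, 0 ≤ x j := by
  have hw : w ≠ 0 := by
    rintro rfl
    simp at hMnorm
  have hsum : ∑ j, M j * Real.exp (-(x j) / ε) = ∑ j, M j :=
    mul_left_cancel₀ hw (hmean.trans hMnorm.symm)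
  have hne : (Finset.univ : Finset ι).Nonempty := by
    rw [Finset.nonempty_iff_ne_empty]
    intro h
    simp [h] at hMnorm
  constructor
  · obtain ⟨j, -, hj⟩ := Finset.exists_le_of_sum_le hne hsum.ge
    refine ⟨j, ?_⟩
    have h1 : 1 ≤ Real.exp (-(x j) / ε) := by nlinarith [hM j]
    rw [Real.one_le_exp_iff, le_div_iff₀ hε] at h1
    linarith
  · obtain ⟨j, -, hj⟩ := Finset.exists_le_of_sum_le hne hsum.le
    refine ⟨j, ?_⟩
    have h1 : Real.exp (-(x j) / ε) ≤ 1 := by nlinarith [hM j]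
    rw [Real.exp_le_one_iff, div_le_iff₀ hε] at h1
    linarith

/-- Bounds on the implicit relaxation operator yield bounds on the macroscopic unknown `p` and on
all the values `p + x j`. -/
theorem relaxation_bounds {ι : Type*} {ε dt r m p : ℝ} {x : ι → ℝ}
    (hε : 0 < ε) (hdt : 0 < dt) (hr : 0 ≤ r) (hm : 0 ≤ m)
    (hlow : ∃ j, x j ≤ 0) (hhigh : ∃ j, 0 ≤ x j)
    (hE : ∀ j, p + x j - dt * (1 - Real.exp (x j / ε))
      + r * dt * Real.exp (x j / ε) * (1 - Real.exp (-(p + x j) / ε)) ∈ Set.Icc 0 m) :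
    p ∈ Set.Icc 0 m ∧ ∀ j, p + x j ∈ Set.Icc 0 m := by
  have lower : ∀ j, x j ≤ 0 → 0 ≤ p + x j := by
    intro j hj
    by_contra! hneg
    have h1 : Real.exp (x j / ε) ≤ 1 :=
      Real.exp_le_one_iff.2 (div_nonpos_of_nonpos_of_nonneg hj hε.le)
    have h2 : 1 ≤ Real.exp (-(p + x j) / ε) :=
      Real.one_le_exp_iff.2 (div_nonneg (by linarith) hε.le)
    have h3 : 0 ≤ r * dt * Real.exp (x j / ε) := by positivity
    have h4 := mul_nonneg hdt.le (sub_nonneg.2 h1)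
    have h5 := mul_nonneg h3 (sub_nonneg.2 h2)
    linarith [(hE j).1]
  have upper : ∀ j, 0 ≤ x j → p + x j ≤ m := by
    intro j hj
    by_contra! hgt
    have h1 : 1 ≤ Real.exp (x j / ε) := Real.one_le_exp_iff.2 (div_nonneg hj hε.le)
    have h2 : Real.exp (-(p + x j) / ε) ≤ 1 :=
      Real.exp_le_one_iff.2 (div_nonpos_of_nonpos_of_nonneg (by linarith) hε.le)
    have h3 : 0 ≤ r * dt * Real.exp (x j / ε) := by positivity
    have h4 := mul_nonneg hdt.le (sub_nonneg.2 h1)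
    have h5 := mul_nonneg h3 (sub_nonneg.2 h2)
    linarith [(hE j).2]
  obtain ⟨k, hk⟩ := hlow
  obtain ⟨l, hl⟩ := hhigh
  have hp0 : 0 ≤ p := by linarith [lower k hk]
  have hpm : p ≤ m := by linarith [upper l hl]
  refine ⟨⟨hp0, hpm⟩, fun j => ?_⟩
  rcases le_total (x j) 0 with hj | hj
  · exact ⟨lower j hj, by linarith⟩
  · exact ⟨by linarith, upper j hj⟩

/-- Discrete maximum principle for the micro–macro scheme. -/
theorem discrete_maximum_principle
    (ε Δt Δx Δv vmax r m : ℝ) (Nv : ℕ)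
    (hε : 0 < ε) (hΔt : 0 < Δt) (hΔx : 0 < Δx) (hΔv : 0 < Δv) (hr : 0 ≤ r)
    (hm : 0 ≤ m) (hNv : 1 ≤ Nv)
    (v M : Fin Nv → ℝ)
    (hv : ∀ j, |v j| ≤ vmax)
    (hM : ∀ j, 0 < M j)
    (hMnorm : Δv * ∑ j, M j = 1)
    (hCFL : vmax * Δt / Δx ≤ 1)
    (φ : ℕ → ℤ → ℝ) (η : ℕ → ℤ → Fin Nv → ℝ) (H : ℕ → ℤ → ℝ)
    (hinit₁ : ∀ i : ℤ, 0 ≤ φ 0 i ∧ φ 0 i ≤ m)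
    (hinit₂ : ∀ (i : ℤ) (j : Fin Nv), η 0 i j = 0)
    (hS1 : ∀ (n : ℕ) (i : ℤ), φ (n+1) i = φ n i - Δt * (H (n+1) i + r))
    (hS2 : ∀ (n : ℕ) (i : ℤ) (j : Fin Nv),
      1 + H (n+1) i + r - (η (n+1) i j - η n i j) / Δt
        - (max (v j) 0 * ((φ n i - φ n (i-1) + η n i j - η n (i-1) j) / Δx)
           + min (v j) 0 * ((φ n (i+1) - φ n i + η n (i+1) j - η n i j) / Δx))
        + r * Real.exp ((r * Δt - φ n i + Δt * H (n+1) i) / ε)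
      = (1 + r) * Real.exp (η (n+1) i j / ε))
    (hS3 : ∀ (n : ℕ) (i : ℤ),
      Δv * ∑ j, M j * Real.exp (-(η (n+1) i j) / ε) = 1) :
    ∀ (n : ℕ) (i : ℤ) (j : Fin Nv),
      (0 ≤ φ n i ∧ φ n i ≤ m) ∧
      (0 ≤ φ n i + η n i j ∧ φ n i + η n i j ≤ m) ∧
      (1 ≤ n →
        0 ≤ φ n i + η n i j - Δt * (1 - Real.exp (η n i j / ε))
            + r * Δt * Real.exp (η n i j / ε)
              * (1 - Real.exp (-(φ n i + η n i j) / ε)) ∧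
        φ n i + η n i j - Δt * (1 - Real.exp (η n i j / ε))
            + r * Δt * Real.exp (η n i j / ε)
              * (1 - Real.exp (-(φ n i + η n i j) / ε)) ≤ m) := by
  have hE : ∀ n, (∀ i j, φ n i + η n i j ∈ Set.Icc 0 m) → ∀ i j,
      φ (n+1) i + η (n+1) i j - Δt * (1 - Real.exp (η (n+1) i j / ε))
        + r * Δt * Real.exp (η (n+1) i j / ε)
          * (1 - Real.exp (-(φ (n+1) i + η (n+1) i j) / ε)) ∈ Set.Icc 0 m := by
    intro n hn i j
    have hup := upwind_step_mem_Icc hΔt hΔx (hv j) hCFL (hn (i-1) j) (hn i j) (hn (i+1) j)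
    convert hup using 1
    have hprod : Real.exp (η (n+1) i j / ε) * Real.exp (-(φ (n+1) i + η (n+1) i j) / ε)
        = Real.exp (-φ (n+1) i / ε) := by
      rw [← Real.exp_add]
      congr 1
      ring
    have h2 := hS2 n i j
    rw [show r * Δt - φ n i + Δt * H (n+1) i = -φ (n+1) i by rw [hS1 n i]; ring] at h2
    have h3 := congrArg (Δt * ·) h2
    have hdiv : Δt * ((η (n+1) i j - η n i j) / Δt) = η (n+1) i j - η n i j :=
      mul_div_cancel₀ _ hΔt.ne'
    simp only [mul_add, mul_sub, hdiv] at h3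
    linear_combination (-1 : ℝ) * h3 + hS1 n i - r * Δt * hprod
  have hbound : ∀ n, (∀ i, φ n i ∈ Set.Icc 0 m) ∧ ∀ i j, φ n i + η n i j ∈ Set.Icc 0 m := by
    intro n
    induction n with
    | zero => exact ⟨hinit₁, fun i j => by simpa [hinit₂] using hinit₁ i⟩
    | succ n ih =>
      have hstep := fun i =>
        have hsign := exists_nonpos_and_exists_nonneg_of_mean_exp_eq_one hε hM hMnorm (hS3 n i)
        relaxation_bounds hε hΔt hr hm hsign.1 hsign.2 (hE n ih.2 i)
      exact ⟨fun i => (hstep i).1, fun i => (hstep i).2⟩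
  intro n i j
  refine ⟨(hbound n).1 i, (hbound n).2 i j, fun hn => ?_⟩
  obtain ⟨k, rfl⟩ := Nat.exists_eq_add_of_le' hn
  exact hE k (hbound k).2 i j
end

section
/- One-step estimate for the micro–macro scheme: fix n ∈ ℕ, i ∈ ℤ, j ∈ {1,…,N_v}, suppose the scheme relations (S1) and (S2) hold at (n,i,j), and assume |v_j|·Δt/Δx ≤ 1. If 0 ≤ φ^n_k + η^n_{k,j} ≤ m for every k ∈ {i−1, i, i+1} (with m ≥ 0), then 0 ≤ E(φ^{n+1}_i, η^{n+1}_{i,j}) ≤ m. -/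
/-- One-step estimate for the micro–macro scheme. -/
theorem one_step_estimate
    (ε Δt Δx Δv r m : ℝ) (Nv : ℕ)
    (hε : 0 < ε) (hΔt : 0 < Δt) (hΔx : 0 < Δx) (hΔv : 0 < Δv) (hr : 0 ≤ r)
    (hm : 0 ≤ m)
    (v M : Fin Nv → ℝ) (hM : ∀ j, 0 < M j)
    (φ : ℕ → ℤ → ℝ) (η : ℕ → ℤ → Fin Nv → ℝ) (H : ℕ → ℤ → ℝ)
    (n : ℕ) (i : ℤ) (j : Fin Nv)
    (hS1 : φ (n+1) i = φ n i - Δt * (H (n+1) i + r))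
    (hS2 : 1 + H (n+1) i + r - (η (n+1) i j - η n i j) / Δt
        - (max (v j) 0 * ((φ n i - φ n (i-1) + η n i j - η n (i-1) j) / Δx)
           + min (v j) 0 * ((φ n (i+1) - φ n i + η n (i+1) j - η n i j) / Δx))
        + r * Real.exp ((r * Δt - φ n i + Δt * H (n+1) i) / ε)
      = (1 + r) * Real.exp (η (n+1) i j / ε))
    (hCFL : |v j| * Δt / Δx ≤ 1)
    (hbounds : ∀ k ∈ ({i - 1, i, i + 1} : Set ℤ),
      0 ≤ φ n k + η n k j ∧ φ n k + η n k j ≤ m) :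
    0 ≤ φ (n+1) i + η (n+1) i j - Δt * (1 - Real.exp (η (n+1) i j / ε))
        + r * Δt * Real.exp (η (n+1) i j / ε)
          * (1 - Real.exp (-(φ (n+1) i + η (n+1) i j) / ε)) ∧
    φ (n+1) i + η (n+1) i j - Δt * (1 - Real.exp (η (n+1) i j / ε))
        + r * Δt * Real.exp (η (n+1) i j / ε)
          * (1 - Real.exp (-(φ (n+1) i + η (n+1) i j) / ε)) ≤ m := by
  have hexp : Real.exp (η (n+1) i j / ε) * Real.exp (-(φ (n+1) i + η (n+1) i j) / ε)
      = Real.exp ((r * Δt - φ n i + Δt * H (n+1) i) / ε) := by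
    rw [← Real.exp_add, hS1]
    congr 1
    ring
  have hdiv : (η (n+1) i j - η n i j) / Δt * Δt = η (n+1) i j - η n i j :=
    div_mul_cancel₀ _ hΔt.ne'
  have hE : φ (n+1) i + η (n+1) i j - Δt * (1 - Real.exp (η (n+1) i j / ε))
        + r * Δt * Real.exp (η (n+1) i j / ε)
          * (1 - Real.exp (-(φ (n+1) i + η (n+1) i j) / ε))
      = (φ n i + η n i j)
        - max (v j) 0 * Δt / Δx * ((φ n i + η n i j) - (φ n (i-1) + η n (i-1) j))
        - min (v j) 0 * Δt / Δx * ((φ n (i+1) + η n (i+1) j) - (φ n i + η n i j)) := by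
    linear_combination hS1 - Δt * hS2 - hdiv - r * Δt * hexp
  obtain ⟨hl₀, hl₁⟩ := hbounds (i - 1) (by simp)
  obtain ⟨hc₀, hc₁⟩ := hbounds i (by simp)
  obtain ⟨hr₀, hr₁⟩ := hbounds (i + 1) (by simp)
  rw [hE]
  rcases le_total 0 (v j) with hv | hv
  · rw [abs_of_nonneg hv] at hCFL
    rw [max_eq_left hv, min_eq_right hv]
    have hc : 0 ≤ v j * Δt / Δx := by positivity
    generalize v j * Δt / Δx = c at hc hCFL ⊢
    simp only [zero_mul, zero_div, sub_zero]
    constructor <;> nlinarith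
  · rw [abs_of_nonpos hv] at hCFL
    rw [max_eq_right hv, min_eq_left hv]
    have hc : 0 ≤ -v j * Δt / Δx :=
      div_nonneg (mul_nonneg (neg_nonneg.mpr hv) hΔt.le) hΔx.le
    have hneg : v j * Δt / Δx = -(-v j * Δt / Δx) := by ring
    rw [hneg]
    generalize -v j * Δt / Δx = c at hc hCFL ⊢
    simp only [zero_mul, zero_div, sub_zero]
    constructor <;> nlinarith
end

section
/- Negativity step of the discrete maximum principle: let ε > 0, Δt > 0, r ≥ 0 and φ, η ∈ ℝ with φ < 0 and η ≤ 0. Then E(φ,η) < 0, where E(φ,η) := φ + η − Δt·(1 − exp(η/ε)) + r·Δt·exp(η/ε)·(1 − exp(−(φ+η)/ε)). Consequently, if E(φ,η) ≥ 0 and η ≤ 0, then φ ≥ 0. -/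
/-- Negativity step of the discrete maximum principle. -/
theorem negativity_step
    (ε Δt r : ℝ) (hε : 0 < ε) (hΔt : 0 < Δt) (hr : 0 ≤ r) :
    ∀ φ η : ℝ,
      (φ < 0 → η ≤ 0 →
        φ + η - Δt * (1 - Real.exp (η / ε))
          + r * Δt * Real.exp (η / ε) * (1 - Real.exp (-(φ + η) / ε)) < 0) ∧
      (η ≤ 0 →
        0 ≤ φ + η - Δt * (1 - Real.exp (η / ε))
          + r * Δt * Real.exp (η / ε) * (1 - Real.exp (-(φ + η) / ε)) →
        0 ≤ φ) := by
  intro φ η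
  have negative : φ < 0 → η ≤ 0 →
      φ + η - Δt * (1 - Real.exp (η / ε))
        + r * Δt * Real.exp (η / ε) * (1 - Real.exp (-(φ + η) / ε)) < 0 := by
    intro hφ hη
    have exp_le : Real.exp (η / ε) ≤ 1 :=
      Real.exp_le_one_iff.mpr (div_nonpos_of_nonpos_of_nonneg hη hε.le)
    have le_exp : 1 ≤ Real.exp (-(φ + η) / ε) :=
      Real.one_le_exp (div_nonneg (by linarith) hε.le)
    have first_term_nonneg : 0 ≤ Δt * (1 - Real.exp (η / ε)) :=
      mul_nonneg hΔt.le (sub_nonneg.mpr exp_le)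
    have second_term_nonpos :
        r * Δt * Real.exp (η / ε) * (1 - Real.exp (-(φ + η) / ε)) ≤ 0 :=
      mul_nonpos_of_nonneg_of_nonpos (by positivity) (sub_nonpos.mpr le_exp)
    linarith
  exact ⟨negative, fun hη hE => le_of_not_gt fun hφ => (negative hφ hη).not_ge hE⟩
end

section
/- Bound on the total phase from the maximum-principle expression: let ε > 0, Δt > 0, r ≥ 0, m ≥ 0, and let φ, η ∈ ℝ satisfy 0 ≤ φ ≤ m and 0 ≤ E(φ,η) ≤ m, where E(φ,η) := φ + η − Δt·(1 − exp(η/ε)) + r·Δt·exp(η/ε)·(1 − exp(−(φ+η)/ε)). Then 0 ≤ φ + η ≤ m. -/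
/-- Bound on the total phase from the maximum-principle expression. -/
theorem total_phase_bound
    (ε Δt r m φ η : ℝ) (hε : 0 < ε) (hΔt : 0 < Δt) (hr : 0 ≤ r) (hm : 0 ≤ m)
    (hφ₀ : 0 ≤ φ) (hφm : φ ≤ m)
    (hE₀ : 0 ≤ φ + η - Δt * (1 - Real.exp (η / ε))
        + r * Δt * Real.exp (η / ε) * (1 - Real.exp (-(φ + η) / ε)))
    (hEm : φ + η - Δt * (1 - Real.exp (η / ε))
        + r * Δt * Real.exp (η / ε) * (1 - Real.exp (-(φ + η) / ε)) ≤ m) :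
    0 ≤ φ + η ∧ φ + η ≤ m := by
  have hrate : 0 ≤ r * Δt * Real.exp (η / ε) := by positivity
  constructor
  · by_contra! h
    have hη : Real.exp (η / ε) ≤ 1 :=
      Real.exp_le_one_iff.2 (div_nonpos_of_nonpos_of_nonneg (by linarith) hε.le)
    have hsum : 1 ≤ Real.exp (-(φ + η) / ε) :=
      Real.one_le_exp (div_nonneg (by linarith) hε.le)
    linarith [mul_nonneg hΔt.le (sub_nonneg.2 hη),
      mul_nonpos_of_nonneg_of_nonpos hrate (sub_nonpos.2 hsum)]
  · by_contra! h
    have hη : 1 ≤ Real.exp (η / ε) :=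
      Real.one_le_exp (div_nonneg (by linarith) hε.le)
    have hsum : Real.exp (-(φ + η) / ε) ≤ 1 :=
      Real.exp_le_one_iff.2 (div_nonpos_of_nonpos_of_nonneg (by linarith) hε.le)
    linarith [mul_nonpos_of_nonneg_of_nonpos hΔt.le (sub_nonpos.2 hη),
      mul_nonneg hrate (sub_nonneg.2 hsum)]
end

section
/- Uniform-in-ε upper bound on the corrector: let ε > 0, Δt > 0, r ≥ 0, m ∈ ℝ, and let φ, η ∈ ℝ satisfy 0 ≤ φ + η and E(φ,η) ≤ m, where E(φ,η) := φ + η − Δt·(1 − exp(η/ε)) + r·Δt·exp(η/ε)·(1 − exp(−(φ+η)/ε)). Then exp(η/ε) ≤ (m + Δt)/Δt; equivalently, η ≤ ε·log((m + Δt)/Δt). -/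
/-- Uniform-in-ε upper bound on the corrector. -/
theorem corrector_upper_bound
    (ε Δt r m φ η : ℝ) (hε : 0 < ε) (hΔt : 0 < Δt) (hr : 0 ≤ r)
    (hφη : 0 ≤ φ + η)
    (hE : φ + η - Δt * (1 - Real.exp (η / ε))
        + r * Δt * Real.exp (η / ε) * (1 - Real.exp (-(φ + η) / ε)) ≤ m) :
    Real.exp (η / ε) ≤ (m + Δt) / Δt ∧ η ≤ ε * Real.log ((m + Δt) / Δt) := by
  have h_exp_le_one : Real.exp (-(φ + η) / ε) ≤ 1 :=
    Real.exp_le_one_iff.mpr (div_nonpos_of_nonpos_of_nonneg (by linarith) hε.le)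
  have h_reaction : 0 ≤ r * Δt * Real.exp (η / ε) * (1 - Real.exp (-(φ + η) / ε)) :=
    mul_nonneg (by positivity) (by linarith)
  have h_bound : Real.exp (η / ε) ≤ (m + Δt) / Δt := by
    rw [le_div_iff₀ hΔt]
    linarith
  refine ⟨h_bound, ?_⟩
  have h_log : η / ε ≤ Real.log ((m + Δt) / Δt) :=
    (Real.le_log_iff_exp_le ((Real.exp_pos _).trans_le h_bound)).mpr h_bound
  rwa [div_le_iff₀' hε] at h_log
end

section
/- The corrector is O(ε): let ε > 0, Δt > 0, Δv > 0, r ≥ 0, m > 0, M_1,…,M_{N_v} > 0, and let φ, η_1,…,η_{N_v} be real numbers such that Δv·Σ_{j=1}^{N_v} M_j·exp(−η_j/ε) = 1 and, for every j, 0 ≤ φ + η_j and E(φ,η_j) ≤ m, where E(φ,η) := φ + η − Δt·(1 − exp(η/ε)) + r·Δt·exp(η/ε)·(1 − exp(−(φ+η)/ε)). Then for every j, |η_j| ≤ ε·max( log((m + Δt)/Δt), −log(Δv·M_j) ); in particular η_j/ε is bounded independently of ε, and η_j tends to 0 as ε tends to 0. -/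
/-- The corrector is O(ε). -/
theorem corrector_O_epsilon
    (ε Δt Δv r m : ℝ) (Nv : ℕ)
    (hε : 0 < ε) (hΔt : 0 < Δt) (hΔv : 0 < Δv) (hr : 0 ≤ r) (hm : 0 < m)
    (M : Fin Nv → ℝ) (hM : ∀ j, 0 < M j)
    (φ : ℝ) (η : Fin Nv → ℝ)
    (hnorm : Δv * ∑ j, M j * Real.exp (-(η j) / ε) = 1)
    (hφη : ∀ j, 0 ≤ φ + η j)
    (hE : ∀ j, φ + η j - Δt * (1 - Real.exp (η j / ε))
        + r * Δt * Real.exp (η j / ε) * (1 - Real.exp (-(φ + η j) / ε)) ≤ m) :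
    ∀ j : Fin Nv,
      |η j| ≤ ε * max (Real.log ((m + Δt) / Δt)) (-Real.log (Δv * M j)) := by
  intro j
  have upper : η j / ε ≤ Real.log ((m + Δt) / Δt) := by
    rw [Real.le_log_iff_exp_le (by positivity), le_div_iff₀ hΔt]
    have hexp : Real.exp (-(φ + η j) / ε) ≤ 1 :=
      Real.exp_le_one_iff.mpr
        (div_nonpos_of_nonpos_of_nonneg (neg_nonpos.mpr (hφη j)) hε.le)
    have hreact : 0 ≤ r * Δt * Real.exp (η j / ε) *
        (1 - Real.exp (-(φ + η j) / ε)) :=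
      mul_nonneg (by positivity) (sub_nonneg.mpr hexp)
    linarith [hE j, hφη j]
  have lower : -(η j) / ε ≤ -Real.log (Δv * M j) := by
    have hpos : 0 < Δv * M j := mul_pos hΔv (hM j)
    have hterm : M j * Real.exp (-(η j) / ε) ≤ ∑ i, M i * Real.exp (-(η i) / ε) :=
      Finset.single_le_sum (f := fun i => M i * Real.exp (-(η i) / ε))
        (fun i _ => mul_nonneg (hM i).le (Real.exp_pos _).le) (Finset.mem_univ j)
    rw [← Real.log_inv, Real.le_log_iff_exp_le (inv_pos.mpr hpos), ← one_div,
      le_div_iff₀ hpos]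
    linarith [mul_le_mul_of_nonneg_left hterm hΔv.le]
  rw [← div_le_iff₀' hε, ← abs_of_pos hε, ← abs_div]
  refine abs_le'.mpr ⟨upper.trans (le_max_left _ _), ?_⟩
  rw [← neg_div]
  exact lower.trans (le_max_right _ _)
end

section
/- Well-posedness of the discrete numerical Hamiltonian: let r ≥ 0, Δv > 0, N_v ≥ 1, v_1,…,v_{N_v} ∈ ℝ and M_1,…,M_{N_v} > 0. For every (p,q) ∈ ℝ² there exists a unique real number h such that 1 + r + h − max(v_j,0)·p − min(v_j,0)·q > 0 for every j ∈ {1,…,N_v} and Δv·Σ_{j=1}^{N_v} M_j/(1 + r + h − max(v_j,0)·p − min(v_j,0)·q) = 1/(1+r). -/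
/-- A sum of simple poles with positive weights takes every positive value exactly once to the
right of all its poles. -/
theorem existsUnique_sum_div_sub_eq {ι : Type*} [Fintype ι] [Nonempty ι] {w c : ι → ℝ}
    (hw : ∀ j, 0 < w j) {t : ℝ} (ht : 0 < t) :
    ∃! h : ℝ, (∀ j, 0 < h - c j) ∧ ∑ j, w j / (h - c j) = t := by
  obtain ⟨k, hk⟩ := Finite.exists_max c
  have hwk : w k ≤ ∑ j, w j :=
    Finset.single_le_sum (fun j _ => (hw j).le) (Finset.mem_univ k)
  have hW : 0 < ∑ j, w j := (hw k).trans_le hwk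
  have hlt : ∀ x, c k + w k / t ≤ x → ∀ j, 0 < x - c j := fun x hx j => by
    have := div_pos (hw k) ht
    linarith [hk j]
  have hab : c k + w k / t ≤ c k + (∑ j, w j) / t := by gcongr
  have hcont : ContinuousOn (fun x => ∑ j, w j / (x - c j))
      (Set.Icc (c k + w k / t) (c k + (∑ j, w j) / t)) :=
    continuousOn_finsetSum _ fun j _ => continuousOn_const.div
      (continuousOn_id.sub continuousOn_const) fun x hx => (hlt x hx.1 j).ne'
  have hupper : ∑ j, w j / (c k + (∑ j, w j) / t - c j) ≤ t := by
    calc ∑ j, w j / (c k + (∑ j, w j) / t - c j)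
        ≤ ∑ j, w j / ((∑ j, w j) / t) := Finset.sum_le_sum fun j _ =>
          div_le_div_of_nonneg_left (hw j).le (div_pos hW ht) (by linarith [hk j])
      _ = t := by
        rw [← Finset.sum_div]
        field_simp
  have hlower : t ≤ ∑ j, w j / (c k + w k / t - c j) := by
    calc t = w k / (c k + w k / t - c k) := by
          have := (hw k).ne'
          rw [add_sub_cancel_left]
          field_simp
      _ ≤ _ := Finset.single_le_sum (f := fun j => w j / (c k + w k / t - c j))
          (fun j _ => (div_pos (hw j) (hlt _ le_rfl j)).le) (Finset.mem_univ k)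
  obtain ⟨h, hh, hsum⟩ := intermediate_value_Icc' hab hcont ⟨hupper, hlower⟩
  have hanti : ∀ x y : ℝ, (∀ j, 0 < x - c j) → x < y →
      ∑ j, w j / (y - c j) < ∑ j, w j / (x - c j) := fun x y hx hxy =>
    Finset.sum_lt_sum_of_nonempty Finset.univ_nonempty fun j _ =>
      div_lt_div_of_pos_left (hw j) (hx j) (by linarith)
  refine ⟨h, ⟨hlt h hh.1, hsum⟩, fun y ⟨hy, hysum⟩ => ?_⟩
  rcases lt_trichotomy y h with hyh | hyh | hyh
  · exact absurd (hsum.trans hysum.symm) (hanti y h hy hyh).ne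
  · exact hyh
  · exact absurd (hysum.trans hsum.symm) (hanti h y (hlt h hh.1) hyh).ne

/-- Well-posedness of the discrete numerical Hamiltonian. -/
theorem numerical_hamiltonian_wellposed
    (r Δv : ℝ) (Nv : ℕ)
    (hr : 0 ≤ r) (hΔv : 0 < Δv) (hNv : 1 ≤ Nv)
    (v M : Fin Nv → ℝ) (hM : ∀ j, 0 < M j) :
    ∀ p q : ℝ, ∃! h : ℝ,
      (∀ j, 0 < 1 + r + h - max (v j) 0 * p - min (v j) 0 * q) ∧
      Δv * ∑ j, M j / (1 + r + h - max (v j) 0 * p - min (v j) 0 * q)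
        = 1 / (1 + r) := by
  intro p q
  have : Nonempty (Fin Nv) := ⟨⟨0, hNv⟩⟩
  have hden : ∀ h j, 1 + r + h - max (v j) 0 * p - min (v j) 0 * q
      = h - (max (v j) 0 * p + min (v j) 0 * q - 1 - r) := fun h j => by ring
  simp only [hden, Finset.mul_sum, ← mul_div_assoc]
  exact existsUnique_sum_div_sub_eq (fun j => mul_pos hΔv (hM j)) (by positivity)
end

section
/- Monotonicity and Lipschitz continuity of the numerical Hamiltonian in its first argument: let r ≥ 0, Δv > 0, v_1,…,v_{N_v} ∈ ℝ, M_1,…,M_{N_v} > 0, and set v_max = max_j |v_j|. Suppose p ≤ p', q ∈ ℝ, and h, h' ∈ ℝ satisfy, with all denominators positive, Δv·Σ_j M_j/(1 + r + h − max(v_j,0)·p − min(v_j,0)·q) = 1/(1+r) and Δv·Σ_j M_j/(1 + r + h' − max(v_j,0)·p' − min(v_j,0)·q) = 1/(1+r). Then h ≤ h' ≤ h + v_max·(p' − p). -/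
/-- Two positive families with equal positively weighted sums of reciprocals cannot be strictly
ordered everywhere. -/
lemma exists_le_of_sum_div_eq {ι : Type*} [Fintype ι] [Nonempty ι] {M a b : ι → ℝ}
    (hM : ∀ j, 0 < M j) (hb : ∀ j, 0 < b j)
    (hab : ∑ j, M j / a j = ∑ j, M j / b j) : ∃ j, a j ≤ b j := by
  by_contra! hlt
  exact hab.not_lt (Finset.sum_lt_sum_of_nonempty Finset.univ_nonempty
    fun j _ => div_lt_div_of_pos_left (hM j) (hb j) (hlt j))

/-- Monotonicity and Lipschitz continuity of the numerical Hamiltonian in its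
first argument. -/
theorem numerical_hamiltonian_first_arg
    (r Δv : ℝ) (Nv : ℕ)
    (hr : 0 ≤ r) (hΔv : 0 < Δv) (hNv : 1 ≤ Nv)
    (v M : Fin Nv → ℝ) (hM : ∀ j, 0 < M j)
    (vmax : ℝ)
    (hvmax : vmax = Finset.univ.sup'
      (Finset.univ_nonempty_iff.mpr (Fin.pos_iff_nonempty.mp (by omega)))
      (fun j => |v j|))
    (p p' q h h' : ℝ) (hpp' : p ≤ p')
    (hden : ∀ j, 0 < 1 + r + h - max (v j) 0 * p - min (v j) 0 * q)
    (hden' : ∀ j, 0 < 1 + r + h' - max (v j) 0 * p' - min (v j) 0 * q)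
    (heq : Δv * ∑ j, M j / (1 + r + h - max (v j) 0 * p - min (v j) 0 * q)
      = 1 / (1 + r))
    (heq' : Δv * ∑ j, M j / (1 + r + h' - max (v j) 0 * p' - min (v j) 0 * q)
      = 1 / (1 + r)) :
    h ≤ h' ∧ h' ≤ h + vmax * (p' - p) := by
  have : Nonempty (Fin Nv) := Fin.pos_iff_nonempty.mp (by omega)
  have hsum := mul_left_cancel₀ hΔv.ne' (heq.trans heq'.symm)
  constructor
  · obtain ⟨j, hj⟩ := exists_le_of_sum_div_eq hM hden' hsum
    have := mul_le_mul_of_nonneg_left hpp' (le_max_right (v j) 0)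
    linarith
  · obtain ⟨j, hj⟩ := exists_le_of_sum_div_eq hM hden hsum.symm
    have hv : max (v j) 0 ≤ vmax := by
      rw [hvmax]
      exact (max_le (le_abs_self _) (abs_nonneg _)).trans
        (Finset.le_sup' (fun j => |v j|) (Finset.mem_univ j))
    have := mul_le_mul_of_nonneg_right hv (sub_nonneg.mpr hpp')
    linarith
end

section
/- Singular set of the quadratic equilibrium: let a > 0 and m > 0, and let M(v) = m·(a² − v²) for v ∈ [−a, a]. Then for every real p ≠ 0, ∫_{−a}^{a} M(v)/(a·|p| − v·p) dv = 2·m·a²/|p|. Consequently, for p ≠ 0, the inequality ∫_{−a}^{a} M(v)/(a·|p| − v·p) dv ≤ 1 holds if and only if |p| ≥ 2·m·a²; that is, p belongs to Sing(M) exactly when |p| ≥ 2·m·a², so every p of sufficiently large modulus belongs to Sing(M). -/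
/-- The integral over `[-a, a]` of the quadratic density against the dispersion kernel. -/
theorem integral_quadratic_div_dispersion (a m : ℝ) {p : ℝ} (hp : p ≠ 0) :
    (∫ v in (-a)..a, m * (a ^ 2 - v ^ 2) / (a * |p| - v * p)) = 2 * m * a ^ 2 / |p| := by
  have hae : ∀ᵐ v : ℝ, v ∈ Set.uIoc (-a) a →
      m * (a ^ 2 - v ^ 2) / (a * |p| - v * p) = m * a / |p| + m / p * v := by
    filter_upwards [MeasureTheory.Measure.ae_ne MeasureTheory.volume (a * |p| / p)] with v hv _
    have hd : a * |p| - v * p ≠ 0 := fun h => hv (by rw [eq_div_iff hp]; linarith)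
    rcases lt_or_gt_of_ne hp with h | h
    · rw [abs_of_neg h] at hd ⊢
      rw [div_eq_iff hd]
      field_simp
      ring
    · rw [abs_of_pos h] at hd ⊢
      rw [div_eq_iff hd]
      field_simp
      ring
  rw [intervalIntegral.integral_congr_ae hae, intervalIntegral.integral_add
    intervalIntegrable_const (Continuous.intervalIntegrable (by fun_prop) _ _),
    intervalIntegral.integral_const, intervalIntegral.integral_const_mul, integral_id]
  simp only [smul_eq_mul]
  ring

/-- Singular set of the quadratic equilibrium. -/
theorem quadratic_equilibrium_singular_set
    (a m : ℝ) (ha : 0 < a) (hm : 0 < m) :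
    ∀ p : ℝ, p ≠ 0 →
      (∫ v in (-a)..a, m * (a ^ 2 - v ^ 2) / (a * |p| - v * p))
        = 2 * m * a ^ 2 / |p| ∧
      ((∫ v in (-a)..a, m * (a ^ 2 - v ^ 2) / (a * |p| - v * p)) ≤ 1 ↔
        2 * m * a ^ 2 ≤ |p|) := by
  intro p hp
  have h := integral_quadratic_div_dispersion a m hp
  exact ⟨h, by rw [h, div_le_one (abs_pos.mpr hp)]⟩
end

section
/- Well-posedness of the implicit Hamiltonian for a positive equilibrium: let v_max > 0, r ≥ 0, and let M : [−v_max, v_max] → ℝ be continuous with inf_{v ∈ [−v_max,v_max]} M(v) > 0 and ∫_{−v_max}^{v_max} M(v) dv = 1. Then for every p ∈ ℝ there exists a unique real number H with H > v_max·|p| − (1+r) and ∫_{−v_max}^{v_max} M(v)/(1 + r + H − v·p) dv = 1/(1+r). -/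
open Set MeasureTheory Filter Topology

lemma sub_mul_abs_le_sub_mul {b v p z : ℝ} (hv : v ∈ Icc (-b) b) :
    z - b * |p| ≤ z - v * p := by
  have h1 : v * p ≤ |v| * |p| := by rw [← abs_mul]; exact le_abs_self _
  have h2 : |v| * |p| ≤ b * |p| :=
    mul_le_mul_of_nonneg_right (abs_le.2 hv) (abs_nonneg p)
  linarith

lemma continuousOn_div_sub_mul {M : ℝ → ℝ} {b p z : ℝ}
    (hM : ContinuousOn M (Icc (-b) b)) (hz : b * |p| < z) :
    ContinuousOn (fun v => M v / (z - v * p)) (Icc (-b) b) := by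
  refine hM.div (by fun_prop) fun v hv => ?_
  have := sub_mul_abs_le_sub_mul (p := p) (z := z) hv
  linarith

lemma integral_div_sub_mul_strictAntiOn {M : ℝ → ℝ} {b : ℝ} (hb : 0 < b)
    (hM : ContinuousOn M (Icc (-b) b)) (hpos : ∀ v ∈ Icc (-b) b, 0 < M v) (p : ℝ) :
    StrictAntiOn (fun z => ∫ v in (-b)..b, M v / (z - v * p)) (Ioi (b * |p|)) := by
  intro z hz w hw hzw
  have key : ∀ v ∈ Icc (-b) b, M v / (w - v * p) < M v / (z - v * p) := fun v hv => by
    have := sub_mul_abs_le_sub_mul (p := p) (z := z) hv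
    exact div_lt_div_of_pos_left (hpos v hv) (by linarith [mem_Ioi.1 hz]) (by linarith)
  refine intervalIntegral.integral_lt_integral_of_continuousOn_of_le_of_exists_lt (by linarith)
    (continuousOn_div_sub_mul hM hw) (continuousOn_div_sub_mul hM hz)
    (fun v hv => (key v (Ioc_subset_Icc_self hv)).le) ⟨b, ?_, key b ?_⟩ <;>
  exact ⟨by linarith, le_rfl⟩

lemma continuousOn_integral_div_sub_mul {M : ℝ → ℝ} {b : ℝ} (hb : 0 < b)
    (hM : ContinuousOn M (Icc (-b) b)) (p : ℝ) :
    ContinuousOn (fun z => ∫ v in (-b)..b, M v / (z - v * p)) (Ioi (b * |p|)) := by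
  intro z hz
  rw [mem_Ioi] at hz
  have hle : -b ≤ b := by linarith
  have hsub : uIoc (-b) b ⊆ Icc (-b) b := by
    rw [uIoc_of_le hle]; exact Ioc_subset_Icc_self
  refine (intervalIntegral.continuousAt_of_dominated_interval
    (bound := fun v => |M v| / ((z - b * |p|) / 2)) ?_ ?_ ?_ ?_).continuousWithinAt
  · filter_upwards [Ioi_mem_nhds hz] with w hw
    exact ((continuousOn_div_sub_mul hM hw).mono hsub).aestronglyMeasurable measurableSet_uIoc
  · filter_upwards [Ioi_mem_nhds (show (z + b * |p|) / 2 < z by linarith)] with w hw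
    refine Eventually.of_forall fun v hv => ?_
    have := sub_mul_abs_le_sub_mul (p := p) (z := w) (hsub hv)
    rw [mem_Ioi] at hw
    rw [Real.norm_eq_abs, abs_div, abs_of_pos (show 0 < w - v * p by linarith)]
    exact div_le_div_of_nonneg_left (abs_nonneg _) (by linarith) (by linarith)
  · apply ContinuousOn.intervalIntegrable
    rw [uIcc_of_le hle]
    exact hM.abs.div_const _
  · refine Eventually.of_forall fun v hv => ?_
    have := sub_mul_abs_le_sub_mul (p := p) (z := z) (hsub hv)
    exact continuousAt_const.div (by fun_prop) (by linarith)

lemma integral_div_sub_mul_le {M : ℝ → ℝ} {b : ℝ} (hb : 0 < b)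
    (hM : ContinuousOn M (Icc (-b) b)) (hnonneg : ∀ v ∈ Icc (-b) b, 0 ≤ M v)
    {p z : ℝ} (hz : b * |p| < z) :
    ∫ v in (-b)..b, M v / (z - v * p) ≤ (∫ v in (-b)..b, M v) / (z - b * |p|) := by
  have hle : -b ≤ b := by linarith
  rw [← intervalIntegral.integral_div]
  refine intervalIntegral.integral_mono_on hle
    ((continuousOn_div_sub_mul hM hz).intervalIntegrable_of_Icc hle)
    ((hM.div_const _).intervalIntegrable_of_Icc hle) fun v hv => ?_
  exact div_le_div_of_nonneg_left (hnonneg v hv) (by linarith) (sub_mul_abs_le_sub_mul hv)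

lemma integral_const_div_sub_mul {b p z : ℝ} (hb : 0 < b) (hp : p ≠ 0) (hz : b * |p| < z) (c : ℝ) :
    ∫ v in (-b)..b, c / (z - v * p) =
      c / |p| * (Real.log (z + b * |p|) - Real.log (z - b * |p|)) := by
  have hle : -b ≤ b := by linarith
  have hderiv : ∀ v ∈ uIcc (-b) b,
      HasDerivAt (fun v => -(c / p) * Real.log (z - v * p)) (c / (z - v * p)) v := by
    intro v hv
    rw [uIcc_of_le hle] at hv
    have := sub_mul_abs_le_sub_mul (p := p) (z := z) hv
    have hne : z - v * p ≠ 0 := by linarith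
    have h := (((hasDerivAt_id v).mul_const p).const_sub z).log hne
    refine (h.const_mul (-(c / p))).congr_deriv ?_
    simp only [id]
    field_simp
  rw [intervalIntegral.integral_eq_sub_of_hasDerivAt hderiv
    ((continuousOn_div_sub_mul continuousOn_const hz).intervalIntegrable_of_Icc hle)]
  rcases lt_or_gt_of_ne hp with h | h
  · rw [abs_of_neg h]
    field_simp
    ring_nf
  · rw [abs_of_pos h]
    field_simp
    ring_nf

lemma exists_le_integral_div_sub_mul {M : ℝ → ℝ} {b c : ℝ} (hb : 0 < b) (hc : 0 < c)
    (hM : ContinuousOn M (Icc (-b) b)) (hcM : ∀ v ∈ Icc (-b) b, c ≤ M v)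
    {p : ℝ} (hp : p ≠ 0) (K : ℝ) :
    ∃ z, b * |p| < z ∧ K ≤ ∫ v in (-b)..b, M v / (z - v * p) := by
  have hle : -b ≤ b := by linarith
  have hp' : 0 < |p| := abs_pos.2 hp
  have ha : 0 < b * |p| := mul_pos hb hp'
  set ε := 2 * (b * |p|) * Real.exp (-(K * |p| / c)) with hε
  have hεpos : 0 < ε := by positivity
  have hz : b * |p| < b * |p| + ε := by linarith
  refine ⟨b * |p| + ε, hz, ?_⟩
  have hlogε : Real.log ε = Real.log (2 * (b * |p|)) - K * |p| / c := by
    rw [hε, Real.log_mul (by positivity) (Real.exp_ne_zero _), Real.log_exp]; ring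
  have hlog : Real.log (2 * (b * |p|)) ≤ Real.log (b * |p| + ε + b * |p|) :=
    Real.log_le_log (by positivity) (by linarith)
  calc K = c / |p| * (K * |p| / c) := by field_simp
    _ ≤ c / |p| * (Real.log (b * |p| + ε + b * |p|) - Real.log (b * |p| + ε - b * |p|)) := by
      refine mul_le_mul_of_nonneg_left ?_ (by positivity)
      rw [add_sub_cancel_left]
      linarith
    _ = ∫ v in (-b)..b, c / (b * |p| + ε - v * p) := (integral_const_div_sub_mul hb hp hz c).symm
    _ ≤ _ := by
      refine intervalIntegral.integral_mono_on hle
        ((continuousOn_div_sub_mul continuousOn_const hz).intervalIntegrable_of_Icc hle)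
        ((continuousOn_div_sub_mul hM hz).intervalIntegrable_of_Icc hle) fun v hv => ?_
      have := sub_mul_abs_le_sub_mul (p := p) (z := b * |p| + ε) hv
      exact div_le_div_of_nonneg_right (hcM v hv) (by linarith)

/-- Well-posedness of the implicit Hamiltonian for a positive equilibrium. -/
theorem implicit_hamiltonian_wellposed
    (vmax r : ℝ) (hvmax : 0 < vmax) (hr : 0 ≤ r)
    (M : ℝ → ℝ)
    (hMc : ContinuousOn M (Set.Icc (-vmax) vmax))
    (hMpos : ∃ c > 0, ∀ v ∈ Set.Icc (-vmax) vmax, c ≤ M v)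
    (hMnorm : (∫ v in (-vmax)..vmax, M v) = 1) :
    ∀ p : ℝ, ∃! H : ℝ,
      vmax * |p| - (1 + r) < H ∧
      (∫ v in (-vmax)..vmax, M v / (1 + r + H - v * p)) = 1 / (1 + r) := by
  intro p
  obtain ⟨c, hc, hcM⟩ := hMpos
  have hpos : ∀ v ∈ Icc (-vmax) vmax, 0 < M v := fun v hv => hc.trans_le (hcM v hv)
  obtain ⟨z, hz, hzF⟩ : ∃ z ∈ Ioi (vmax * |p|),
      ∫ v in (-vmax)..vmax, M v / (z - v * p) = 1 / (1 + r) := by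
    have hz₁ : vmax * |p| < vmax * |p| + (1 + r) := by linarith
    have hupper := integral_div_sub_mul_le hvmax hMc (fun v hv => (hpos v hv).le) hz₁
    rw [hMnorm, add_sub_cancel_left] at hupper
    obtain ⟨z₀, hz₀, hlower⟩ : ∃ z, vmax * |p| < z ∧
        1 / (1 + r) ≤ ∫ v in (-vmax)..vmax, M v / (z - v * p) := by
      rcases eq_or_ne p 0 with rfl | hp
      · refine ⟨1 + r, by simp; linarith, ?_⟩
        simp [hMnorm]
      · exact exists_le_integral_div_sub_mul hvmax hc hMc hcM hp _
    exact isPreconnected_Ioi.intermediate_value hz₁ hz₀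
      (continuousOn_integral_div_sub_mul hvmax hMc p) ⟨hupper, hlower⟩
  refine ⟨z - (1 + r), ⟨by linarith [mem_Ioi.1 hz], by simpa using hzF⟩, ?_⟩
  rintro H ⟨hH, hHF⟩
  have := (integral_div_sub_mul_strictAntiOn hvmax hMc hpos p).injOn
    (show 1 + r + H ∈ Ioi (vmax * |p|) by rw [mem_Ioi]; linarith) hz (hHF.trans hzF.symm)
  linarith
end

section
/- Existence and uniqueness of the Hamiltonian outside the singular set, for a possibly vanishing equilibrium: let v_max > 0, let M : [−v_max, v_max] → ℝ be continuous and nonnegative with ∫_{−v_max}^{v_max} M(v) dv = 1, let p ≠ 0 and set μ(p) = v_max·|p|. Assume that the Lebesgue integral (with values in [0, ∞]) ∫_{−v_max}^{v_max} M(v)/(μ(p) − v·p) dv is strictly greater than 1 (i.e. p does not belong to Sing(M)). Then there exists a unique real number H with H > μ(p) − 1 and ∫_{−v_max}^{v_max} M(v)/(1 + H − v·p) dv = 1. -/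
open MeasureTheory Set Filter Topology in
/-- If `∫ M / w > 1` as a Lebesgue integral, then `∫ M / (s + w) > 1` for some `s > 0`. -/
theorem exists_pos_one_lt_integral_div_add {a b : ℝ} (hab : a ≤ b) {M w : ℝ → ℝ}
    (hMc : ContinuousOn M (Icc a b)) (hMnn : ∀ v ∈ Icc a b, 0 ≤ M v)
    (hwc : ContinuousOn w (Icc a b)) (hwnn : ∀ v ∈ Icc a b, 0 ≤ w v)
    (h : 1 < ∫⁻ v in Icc a b, ENNReal.ofReal (M v) / ENNReal.ofReal (w v)) :
    ∃ s : ℝ, 0 < s ∧ 1 < ∫ v in a..b, M v / (s + w v) := by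
  by_contra! hcon
  have hs : ∀ n : ℕ, (0 : ℝ) < 1 / ((n : ℝ) + 1) := fun n => Nat.one_div_pos_of_nat
  have hle : ∀ n : ℕ, ∫⁻ v in Icc a b,
      ENNReal.ofReal (M v) / ENNReal.ofReal (1 / ((n : ℝ) + 1) + w v) ≤ 1 := by
    intro n
    have hpos : ∀ v ∈ Icc a b, 0 < 1 / ((n : ℝ) + 1) + w v := fun v hv =>
      add_pos_of_pos_of_nonneg (hs n) (hwnn v hv)
    have hint : IntegrableOn (fun v => M v / (1 / ((n : ℝ) + 1) + w v)) (Icc a b) :=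
      (hMc.div (continuousOn_const.add hwc) fun v hv => (hpos v hv).ne').integrableOn_Icc
    have h1 := hcon _ (hs n)
    rw [intervalIntegral.integral_of_le hab, ← integral_Icc_eq_integral_Ioc] at h1
    rw [setLIntegral_congr_fun measurableSet_Icc
      (fun v hv => (ENNReal.ofReal_div_of_pos (hpos v hv)).symm),
      ← ofReal_integral_eq_lintegral_ofReal hint]
    · exact ENNReal.ofReal_le_one.2 h1
    · filter_upwards [ae_restrict_mem measurableSet_Icc] with v hv
      exact div_nonneg (hMnn v hv) (hpos v hv).le
  have hlim : ∀ v, Tendsto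
      (fun n : ℕ => ENNReal.ofReal (M v) / ENNReal.ofReal (1 / ((n : ℝ) + 1) + w v)) atTop
      (𝓝 (ENNReal.ofReal (M v) / ENNReal.ofReal (w v))) := by
    intro v
    refine ENNReal.Tendsto.const_div (ENNReal.tendsto_ofReal ?_) (Or.inr ENNReal.ofReal_ne_top)
    simpa using (tendsto_one_div_add_atTop_nhds_zero_nat (𝕜 := ℝ)).add_const (w v)
  have hfatou := lintegral_liminf_le' (u := atTop) (μ := volume.restrict (Icc a b)) (f := fun (n : ℕ) v =>
      ENNReal.ofReal (M v) / ENNReal.ofReal (1 / ((n : ℝ) + 1) + w v)) (fun n =>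
      (hMc.aemeasurable measurableSet_Icc).ennreal_ofReal.div
        ((hwc.aemeasurable measurableSet_Icc).const_add _).ennreal_ofReal)
  simp only [fun v => (hlim v).liminf_eq] at hfatou
  refine absurd (h.trans_le (hfatou.trans ?_)) (lt_irrefl _)
  exact (liminf_le_liminf (Eventually.of_forall hle)).trans (by simp)

/-- `s ↦ ∫ M / (s + w)` is strictly antitone on the positive reals. -/
theorem integral_div_add_lt_integral_div_add {a b : ℝ} (hab : a ≤ b) {M w : ℝ → ℝ}
    (hMc : ContinuousOn M (Set.Icc a b)) (hMnn : ∀ v ∈ Set.Icc a b, 0 ≤ M v)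
    (hM : 0 < ∫ v in a..b, M v)
    (hwc : ContinuousOn w (Set.Icc a b)) (hwnn : ∀ v ∈ Set.Icc a b, 0 ≤ w v)
    {s t : ℝ} (hs : 0 < s) (hst : s < t) :
    ∫ v in a..b, M v / (t + w v) < ∫ v in a..b, M v / (s + w v) := by
  obtain ⟨C, hC⟩ := (isCompact_Icc (a := a) (b := b)).bddAbove_image hwc
  have hwC : ∀ v ∈ Set.Icc a b, w v ≤ C := fun v hv => hC (Set.mem_image_of_mem w hv)
  have hC0 : 0 ≤ C := (hwnn a ⟨le_rfl, hab⟩).trans (hwC a ⟨le_rfl, hab⟩)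
  have ht : 0 < t := hs.trans hst
  have hint : ∀ r : ℝ, 0 < r →
      IntervalIntegrable (fun v => M v / (r + w v)) MeasureTheory.volume a b := fun r hr =>
    (hMc.div (continuousOn_const.add hwc) fun v hv =>
      (add_pos_of_pos_of_nonneg hr (hwnn v hv)).ne').intervalIntegrable_of_Icc hab
  have hc : 0 < (t - s) / ((s + C) * (t + C)) := div_pos (sub_pos.2 hst) (by positivity)
  have key : ∫ v in a..b, (t - s) / ((s + C) * (t + C)) * M v ≤
      ∫ v in a..b, (M v / (s + w v) - M v / (t + w v)) := by
    refine intervalIntegral.integral_mono_on hab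
      ((hMc.intervalIntegrable_of_Icc hab).const_mul _) ((hint s hs).sub (hint t ht)) ?_
    intro v hv
    have h0 := hwnn v hv
    have h1 := hwC v hv
    have h2 : M v / (s + w v) - M v / (t + w v) =
        (t - s) / ((s + w v) * (t + w v)) * M v := by
      field_simp
      ring
    rw [h2]
    refine mul_le_mul_of_nonneg_right ?_ (hMnn v hv)
    have : 0 ≤ t - s := (sub_pos.2 hst).le
    gcongr
  rw [intervalIntegral.integral_const_mul,
    intervalIntegral.integral_sub (hint s hs) (hint t ht)] at key
  linarith [mul_pos hc hM]

/-- `s ↦ ∫ M / (s + w)` is continuous on `[s₀, ∞)` for `s₀ > 0`. -/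
theorem continuousOn_integral_div_add {a b : ℝ} (hab : a ≤ b) {M w : ℝ → ℝ}
    (hMc : ContinuousOn M (Set.Icc a b)) (hMnn : ∀ v ∈ Set.Icc a b, 0 ≤ M v)
    (hwc : ContinuousOn w (Set.Icc a b)) (hwnn : ∀ v ∈ Set.Icc a b, 0 ≤ w v)
    {s₀ : ℝ} (hs₀ : 0 < s₀) :
    ContinuousOn (fun s => ∫ v in a..b, M v / (s + w v)) (Set.Ici s₀) := by
  intro s hs
  have hmem : ∀ v ∈ Set.uIoc a b, v ∈ Set.Icc a b := fun v hv => by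
    rw [Set.uIoc_of_le hab] at hv
    exact Set.Ioc_subset_Icc_self hv
  have hpos : ∀ r ∈ Set.Ici s₀, ∀ v ∈ Set.Icc a b, 0 < r + w v := fun r hr v hv =>
    add_pos_of_pos_of_nonneg (hs₀.trans_le hr) (hwnn v hv)
  refine intervalIntegral.continuousWithinAt_of_dominated_interval
    (bound := fun v => M v / s₀) ?_ ?_ ?_ ?_
  · filter_upwards [self_mem_nhdsWithin] with r hr
    exact ((hMc.div (continuousOn_const.add hwc) fun v hv =>
      (hpos r hr v hv).ne').intervalIntegrable_of_Icc hab).aestronglyMeasurable_restrict_uIoc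
  · filter_upwards [self_mem_nhdsWithin] with r hr
    refine Filter.Eventually.of_forall fun v hv => ?_
    have hM := hMnn v (hmem v hv)
    rw [Real.norm_of_nonneg (div_nonneg hM (hpos r hr v (hmem v hv)).le)]
    have h1 := hwnn v (hmem v hv)
    have h2 : s₀ ≤ r := hr
    exact div_le_div_of_nonneg_left hM hs₀ (by linarith)
  · exact (hMc.intervalIntegrable_of_Icc hab).div_const _
  · refine Filter.Eventually.of_forall fun v hv => ?_
    exact (continuousAt_const.div (continuousAt_id.add continuousAt_const)
      (hpos s hs v (hmem v hv)).ne').continuousWithinAt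

/-- Existence and uniqueness of the Hamiltonian outside the singular set, for a
possibly vanishing equilibrium (linear case `r = 0`). -/
theorem hamiltonian_outside_singular_set
    (vmax : ℝ) (hvmax : 0 < vmax)
    (M : ℝ → ℝ)
    (hMc : ContinuousOn M (Set.Icc (-vmax) vmax))
    (hMnn : ∀ v ∈ Set.Icc (-vmax) vmax, 0 ≤ M v)
    (hMnorm : (∫ v in (-vmax)..vmax, M v) = 1)
    (p : ℝ) (hp : p ≠ 0)
    (hsing : 1 < ∫⁻ v in Set.Icc (-vmax) vmax,
        ENNReal.ofReal (M v) / ENNReal.ofReal (vmax * |p| - v * p)) :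
    ∃! H : ℝ,
      vmax * |p| - 1 < H ∧
      (∫ v in (-vmax)..vmax, M v / (1 + H - v * p)) = 1 := by
  have hab : -vmax ≤ vmax := by linarith
  have hwc : ContinuousOn (fun v => vmax * |p| - v * p) (Set.Icc (-vmax) vmax) := by fun_prop
  have hwnn : ∀ v ∈ Set.Icc (-vmax) vmax, 0 ≤ vmax * |p| - v * p := by
    intro v hv
    have h1 : v * p ≤ |v| * |p| := (le_abs_self _).trans (abs_mul v p).le
    have h2 : |v| * |p| ≤ vmax * |p| := by
      gcongr
      exact abs_le.2 hv
    linarith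
  have hM : 0 < ∫ v in (-vmax)..vmax, M v := by rw [hMnorm]; exact one_pos
  have hanti : ∀ s t : ℝ, 0 < s → s < t →
      ∫ v in (-vmax)..vmax, M v / (t + (vmax * |p| - v * p)) <
        ∫ v in (-vmax)..vmax, M v / (s + (vmax * |p| - v * p)) := fun s t hs hst =>
    integral_div_add_lt_integral_div_add hab hMc hMnn hM hwc hwnn hs hst
  obtain ⟨a, ha, hFa⟩ := exists_pos_one_lt_integral_div_add hab hMc hMnn hwc hwnn hsing
  have hFb : ∫ v in (-vmax)..vmax, M v / (a + 1 + (vmax * |p| - v * p)) ≤ 1 := by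
    rw [← hMnorm]
    refine intervalIntegral.integral_mono_on hab ?_ (hMc.intervalIntegrable_of_Icc hab) ?_
    · exact (hMc.div (continuousOn_const.add hwc) fun v hv =>
        (add_pos_of_pos_of_nonneg (by linarith) (hwnn v hv)).ne').intervalIntegrable_of_Icc hab
    · exact fun v hv => div_le_self (hMnn v hv) (by linarith [hwnn v hv])
  obtain ⟨s, hs, hFs⟩ := intermediate_value_Icc' (by linarith : a ≤ a + 1)
    ((continuousOn_integral_div_add hab hMc hMnn hwc hwnn ha).mono Set.Icc_subset_Ici_self)
    ⟨hFb, hFa.le⟩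
  have hs0 : 0 < s := ha.trans_le hs.1
  refine ⟨s + vmax * |p| - 1, ⟨by linarith, ?_⟩, ?_⟩
  · refine Eq.trans ?_ hFs
    congr! 3
    ring
  · rintro H ⟨hH, hFH⟩
    have hFt : ∫ v in (-vmax)..vmax,
        M v / ((1 + H - vmax * |p|) + (vmax * |p| - v * p)) = 1 := by
      refine Eq.trans ?_ hFH
      congr! 3
      ring
    rcases lt_trichotomy s (1 + H - vmax * |p|) with h | h | h
    · exact absurd (hFt.trans hFs.symm) (hanti _ _ hs0 h).ne
    · linarith
    · exact absurd (hFs.trans hFt.symm) (hanti _ _ (by linarith) h).ne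
end

section
/- Asymptotic-preserving limit of the implicit micro–macro relation: let Δt > 0, Δv > 0, r ≥ 0, N_v ≥ 1 and M_1,…,M_{N_v} > 0 with Δv·Σ_{j=1}^{N_v} M_j = 1. Let (ε_k) be a sequence of positive reals with ε_k → 0, and for each k let real numbers H_k, φ'_k and η_{k,j}, η'_{k,j}, T_{k,j} (j = 1,…,N_v) satisfy, for every j: 1 + H_k + r − (η'_{k,j} − η_{k,j})/Δt − T_{k,j} + r·exp(−φ'_k/ε_k) = (1+r)·exp(η'_{k,j}/ε_k), and Δv·Σ_{j=1}^{N_v} M_j·exp(−η'_{k,j}/ε_k) = 1. Assume that, as k → ∞, η_{k,j} → 0 and η'_{k,j} → 0 for every j, T_{k,j} → T_j, H_k → H⁰, and φ'_k → φ' with φ' > 0. Then for every j, 1 + r + H⁰ − T_j ≥ (1+r)·Δv·M_j > 0, and Δv·Σ_{j=1}^{N_v} M_j/(1 + r + H⁰ − T_j) = 1/(1+r). -/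
/-- Asymptotic-preserving limit of the implicit micro–macro relation. -/
theorem ap_limit_micromacro
    (Δt Δv r : ℝ) (Nv : ℕ)
    (hΔt : 0 < Δt) (hΔv : 0 < Δv) (hr : 0 ≤ r) (hNv : 1 ≤ Nv)
    (M : Fin Nv → ℝ) (hM : ∀ j, 0 < M j)
    (hMnorm : Δv * ∑ j, M j = 1)
    (ε : ℕ → ℝ) (hε : ∀ k, 0 < ε k)
    (hε0 : Filter.Tendsto ε Filter.atTop (nhds 0))
    (H φ' : ℕ → ℝ) (η η' T : ℕ → Fin Nv → ℝ)
    (hS2 : ∀ (k : ℕ) (j : Fin Nv),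
      1 + H k + r - (η' k j - η k j) / Δt - T k j
        + r * Real.exp (-(φ' k) / ε k)
      = (1 + r) * Real.exp (η' k j / ε k))
    (hS3 : ∀ k : ℕ, Δv * ∑ j, M j * Real.exp (-(η' k j) / ε k) = 1)
    (Hlim φlim : ℝ) (Tlim : Fin Nv → ℝ)
    (hηlim : ∀ j, Filter.Tendsto (fun k => η k j) Filter.atTop (nhds 0))
    (hη'lim : ∀ j, Filter.Tendsto (fun k => η' k j) Filter.atTop (nhds 0))
    (hTlim : ∀ j, Filter.Tendsto (fun k => T k j) Filter.atTop (nhds (Tlim j)))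
    (hHlim : Filter.Tendsto H Filter.atTop (nhds Hlim))
    (hφlim : Filter.Tendsto φ' Filter.atTop (nhds φlim))
    (hφpos : 0 < φlim) :
    (∀ j, (1 + r) * Δv * M j ≤ 1 + r + Hlim - Tlim j ∧ 0 < (1 + r) * Δv * M j) ∧
    Δv * ∑ j, M j / (1 + r + Hlim - Tlim j) = 1 / (1 + r) := by
  have hr1 : 0 < 1 + r := by linarith
  have hε_inv : Filter.Tendsto (fun k => (ε k)⁻¹) Filter.atTop Filter.atTop :=
    tendsto_inv_nhdsGT_zero.comp
      (tendsto_nhdsWithin_iff.2 ⟨hε0, Filter.Eventually.of_forall hε⟩)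
  have hreact : Filter.Tendsto (fun k => Real.exp (-(φ' k) / ε k)) Filter.atTop (nhds 0) := by
    refine (Real.tendsto_exp_neg_atTop_nhds_zero.comp
      (hφlim.pos_mul_atTop hφpos hε_inv)).congr fun k => ?_
    simp [div_eq_mul_inv]
  have hmicro : ∀ j, Filter.Tendsto (fun k => (1 + r) * Real.exp (η' k j / ε k))
      Filter.atTop (nhds (1 + r + Hlim - Tlim j)) := by
    intro j
    have h := ((((hHlim.const_add 1).add_const r).sub
      (((hη'lim j).sub (hηlim j)).div_const Δt)).sub (hTlim j)).add (hreact.const_mul r)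
    convert h.congr fun k => hS2 k j using 2
    ring
  have hlower : ∀ k j, Δv * M j ≤ Real.exp (η' k j / ε k) := by
    intro k j
    have hsingle := Finset.single_le_sum
      (f := fun i => M i * Real.exp (-(η' k i) / ε k))
      (fun i _ => (mul_pos (hM i) (Real.exp_pos _)).le) (Finset.mem_univ j)
    have hle : Δv * (M j * Real.exp (-(η' k j) / ε k)) ≤ 1 :=
      (mul_le_mul_of_nonneg_left hsingle hΔv.le).trans_eq (hS3 k)
    rwa [neg_div, Real.exp_neg, ← mul_assoc, ← div_eq_mul_inv,
      div_le_one (Real.exp_pos _)] at hle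
  have hpos : ∀ j, 0 < (1 + r) * Δv * M j := fun j => mul_pos (mul_pos hr1 hΔv) (hM j)
  have hlim_lower : ∀ j, (1 + r) * Δv * M j ≤ 1 + r + Hlim - Tlim j := fun j =>
    ge_of_tendsto' (hmicro j) fun k => by
      rw [mul_assoc]
      exact mul_le_mul_of_nonneg_left (hlower k j) hr1.le
  refine ⟨fun j => ⟨hlim_lower j, hpos j⟩, ?_⟩
  have hsum : Filter.Tendsto
      (fun k => Δv * ∑ j, M j / ((1 + r) * Real.exp (η' k j / ε k)))
      Filter.atTop (nhds (Δv * ∑ j, M j / (1 + r + Hlim - Tlim j))) :=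
    (tendsto_finsetSum _ fun j _ => tendsto_const_nhds.div (hmicro j)
      ((hpos j).trans_le (hlim_lower j)).ne').const_mul Δv
  refine tendsto_nhds_unique (hsum.congr fun k => ?_) tendsto_const_nhds
  rw [← hS3 k, mul_div_assoc, Finset.sum_div]
  congr 1
  refine Finset.sum_congr rfl fun j _ => ?_
  rw [neg_div, Real.exp_neg]
  field_simp
end

section
/- A priori maximum principle for the Hopf–Cole phase of the scaled kinetic equation: let ε > 0, r ≥ 0, d ≥ 1, let V ⊂ ℝ^d be compact with M : V → ℝ continuous, M ≥ 0 and ∫_V M(v) dv = 1, let T > 0 and C ≥ 0. Let ψ : [0,T] × ℝ^d × V → ℝ be a bounded C¹ function, uniformly Lipschitz in (x,v), satisfying for all (t,x,v) ∈ (0,T) × ℝ^d × V: ∂_t ψ + v·∇_x ψ = 1 + r·⟨M e^{−ψ/ε}⟩ − (1+r)·⟨M e^{−ψ/ε}⟩·e^{ψ/ε}, where ⟨g⟩(t,x) = ∫_V g(t,x,v) dv. If 0 ≤ ψ(0,x,v) ≤ C for all (x,v), then 0 ≤ ψ(t,x,v) ≤ C for all (t,x,v) ∈ [0,T] × ℝ^d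 × V. -/
open MeasureTheory

/-- A function which starts nonnegative and is nondecreasing wherever it is negative
stays nonnegative. -/
theorem nonneg_of_deriv_nonneg_of_neg {F F' : ℝ → ℝ} {T : ℝ}
    (hc : ContinuousOn F (Set.Icc 0 T))
    (hd : ∀ s ∈ Set.Ioo 0 T, HasDerivAt F (F' s) s) (h0 : 0 ≤ F 0)
    (hF' : ∀ s ∈ Set.Ioo 0 T, F s < 0 → 0 ≤ F' s) :
    ∀ t ∈ Set.Icc 0 T, 0 ≤ F t := by
  intro t ht
  by_contra! hneg
  -- the last time before `t` at which `F` is nonnegative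
  let A : Set ℝ := Set.Icc 0 t ∩ F ⁻¹' Set.Ici 0
  have hct : ContinuousOn F (Set.Icc 0 t) := hc.mono (Set.Icc_subset_Icc_right ht.2)
  have hA : IsCompact A :=
    isCompact_Icc.of_isClosed_subset (hct.preimage_isClosed_of_isClosed isClosed_Icc isClosed_Ici)
      Set.inter_subset_left
  obtain ⟨a, ⟨⟨ha0, hat⟩, hFa⟩, hmax⟩ := hA.exists_isGreatest ⟨0, ⟨le_rfl, ht.1⟩, h0⟩
  have hFa : 0 ≤ F a := hFa
  have hlt : ∀ s ∈ Set.Ioc a t, F s < 0 := by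
    intro s hs
    by_contra! h
    exact absurd (hmax ⟨⟨ha0.trans hs.1.le, hs.2⟩, h⟩) (not_le.2 hs.1)
  have hmono : MonotoneOn F (Set.Icc a t) := by
    refine monotoneOn_of_hasDerivWithinAt_nonneg (f' := F') (convex_Icc a t)
      (hct.mono (Set.Icc_subset_Icc_left ha0)) ?_ ?_
    all_goals
      intro s hs
      rw [interior_Icc] at hs
      have hs' : s ∈ Set.Ioo 0 T := ⟨ha0.trans_lt hs.1, hs.2.trans_le ht.2⟩
    · exact (hd s hs').hasDerivWithinAt
    · exact hF' s hs' (hlt s ⟨hs.1, hs.2.le⟩)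
  exact absurd (hmono ⟨le_rfl, hat⟩ ⟨hat, le_rfl⟩ hat) (by linarith)

/-- Positivity for transport inequalities with a nonlocal source: if along the characteristics
`s ↦ (x + s • v, v)` a bounded function `u` decreases, at points where it is negative, at most at
rate `κ` times the size of its global lower bound at that time, and if `u` is initially
nonnegative, then `u` stays nonnegative. -/
theorem nonneg_of_transport_lower_bound {E : Type*} [AddCommGroup E] [Module ℝ E]
    {V : Set E} {T κ K : ℝ} (hκ : 0 < κ) (u D : ℝ → E → E → ℝ)
    (hbdd : ∀ s x v, -K ≤ u s x v)
    (hcont : ∀ x, ∀ v ∈ V, ContinuousOn (fun s => u s (x + s • v) v) (Set.Icc 0 T))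
    (hderiv : ∀ s ∈ Set.Ioo 0 T, ∀ x, ∀ v ∈ V,
      HasDerivAt (fun s => u s (x + s • v) v) (D s (x + s • v) v) s)
    (hD : ∀ s ∈ Set.Ioo 0 T, ∀ x, ∀ v ∈ V, ∀ B, (∀ w ∈ V, -B ≤ u s x w) →
      u s x v < 0 → -(κ * B) ≤ D s x v)
    (hinit : ∀ x, ∀ v ∈ V, 0 ≤ u 0 x v) :
    ∀ t ∈ Set.Icc 0 T, ∀ x, ∀ v ∈ V, 0 ≤ u t x v := by
  have step : ∀ B : ℝ, 0 ≤ B →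
      (∀ t ∈ Set.Icc 0 T, ∀ x, ∀ v ∈ V, -(B * Real.exp (2 * κ * t)) ≤ u t x v) →
      ∀ t ∈ Set.Icc 0 T, ∀ x, ∀ v ∈ V, -(B / 2 * Real.exp (2 * κ * t)) ≤ u t x v := by
    intro B hB h t ht x v hv
    have hexp : ∀ s : ℝ, HasDerivAt (fun s => B / 2 * Real.exp (2 * κ * s))
        (κ * (B * Real.exp (2 * κ * s))) s := by
      intro s
      refine ((((hasDerivAt_id' s).const_mul (2 * κ)).exp).const_mul (B / 2)).congr_deriv ?_
      ring
    have key := nonneg_of_deriv_nonneg_of_neg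
      (F := fun s => u s (x - t • v + s • v) v + B / 2 * Real.exp (2 * κ * s))
      (F' := fun s => D s (x - t • v + s • v) v + κ * (B * Real.exp (2 * κ * s)))
      ((hcont _ v hv).add fun s _ => (hexp s).continuousAt.continuousWithinAt)
      (fun s hs => (hderiv s hs _ v hv).add (hexp s))
      (add_nonneg (by simpa using hinit (x - t • v + (0 : ℝ) • v) v hv) (by positivity))
      (fun s hs hneg => by
        have hneg' : u s (x - t • v + s • v) v < 0 := by
          have : 0 ≤ B / 2 * Real.exp (2 * κ * s) := by positivity
          linarith
        have := hD s hs (x - t • v + s • v) v hv _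
          (fun w hw => h s (Set.Ioo_subset_Icc_self hs) _ w hw) hneg'
        linarith) t ht
    simp only [sub_add_cancel] at key
    linarith
  have iter : ∀ n : ℕ, ∀ t ∈ Set.Icc 0 T, ∀ x, ∀ v ∈ V,
      -(|K| * (1 / 2) ^ n * Real.exp (2 * κ * t)) ≤ u t x v := by
    intro n
    induction n with
    | zero =>
      intro t ht x v _
      have h1 : 1 ≤ Real.exp (2 * κ * t) := Real.one_le_exp (by have := ht.1; positivity)
      have h2 := hbdd t x v
      have h3 := le_abs_self K
      have h4 := le_mul_of_one_le_right (abs_nonneg K) h1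
      simp only [pow_zero, mul_one]
      linarith
    | succ n ih =>
      intro t ht x v hv
      convert step _ (by positivity) ih t ht x v hv using 3
      ring
  intro t ht x v hv
  have hlim : Filter.Tendsto (fun n : ℕ => -(|K| * (1 / 2 : ℝ) ^ n * Real.exp (2 * κ * t)))
      Filter.atTop (nhds 0) := by
    have := (((tendsto_pow_atTop_nhds_zero_of_lt_one (r := (1 / 2 : ℝ)) (by norm_num)
      (by norm_num)).const_mul |K|).mul_const (Real.exp (2 * κ * t))).neg
    simpa using this
  exact le_of_tendsto' hlim fun n => iter n t ht x v hv

/-- A priori maximum principle for the Hopf–Cole phase of the scaled kinetic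
equation. -/
theorem hopf_cole_maximum_principle
    (ε r T C : ℝ) (d : ℕ) (hd : 1 ≤ d)
    (hε : 0 < ε) (hr : 0 ≤ r) (hT : 0 < T) (hC : 0 ≤ C)
    (V : Set (Fin d → ℝ)) (hV : IsCompact V)
    (M : (Fin d → ℝ) → ℝ)
    (hMc : ContinuousOn M V) (hMnn : ∀ v ∈ V, 0 ≤ M v)
    (hMnorm : (∫ v in V, M v) = 1)
    (ψ : ℝ × (Fin d → ℝ) × (Fin d → ℝ) → ℝ)
    (hψC1 : ContDiff ℝ 1 ψ)
    (hψbdd : ∃ B : ℝ, ∀ q, |ψ q| ≤ B)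
    (hψlip : ∃ L : ℝ, ∀ (t : ℝ) (x x' v v' : Fin d → ℝ),
      |ψ (t, x, v) - ψ (t, x', v')| ≤ L * (‖x - x'‖ + ‖v - v'‖))
    (heq : ∀ (t : ℝ) (x v : Fin d → ℝ), t ∈ Set.Ioo 0 T → v ∈ V →
      fderiv ℝ ψ (t, x, v) (1, v, 0)
        = 1 + r * (∫ w in V, M w * Real.exp (-ψ (t, x, w) / ε))
          - (1 + r) * (∫ w in V, M w * Real.exp (-ψ (t, x, w) / ε))
            * Real.exp (ψ (t, x, v) / ε))
    (hinit : ∀ (x v : Fin d → ℝ), v ∈ V →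
      0 ≤ ψ (0, x, v) ∧ ψ (0, x, v) ≤ C) :
    ∀ (t : ℝ) (x v : Fin d → ℝ), t ∈ Set.Icc 0 T → v ∈ V →
      0 ≤ ψ (t, x, v) ∧ ψ (t, x, v) ≤ C := by
  obtain ⟨B, hB⟩ := hψbdd
  let g : ℝ → (Fin d → ℝ) → (Fin d → ℝ) → ℝ := fun t x v => Real.exp (-ψ (t, x, v) / ε)
  let I : ℝ → (Fin d → ℝ) → ℝ := fun t x => ∫ w in V, M w * g t x w
  let G : ℝ → (Fin d → ℝ) → (Fin d → ℝ) → ℝ := fun t x v =>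
    ((1 + r) * I t x - g t x v * (1 + r * I t x)) / ε
  have hVm : MeasurableSet V := hV.measurableSet
  have hMi : IntegrableOn M V := hMc.integrableOn_compact hV
  have hgc : ∀ t x, Continuous (g t x) := fun t x => by
    have := hψC1.continuous
    fun_prop
  have hMgi : ∀ t x, IntegrableOn (fun w => M w * g t x w) V := fun t x =>
    (hMc.mul (hgc t x).continuousOn).integrableOn_compact hV
  have hgpos : ∀ t x v, 0 < g t x v := fun t x v => Real.exp_pos _
  have hI0 : ∀ t x, 0 ≤ I t x := fun t x =>
    setIntegral_nonneg hVm fun w hw => mul_nonneg (hMnn w hw) (hgpos t x w).le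
  have hI_ge : ∀ t x a, (∀ w ∈ V, a ≤ g t x w) → a ≤ I t x := fun t x a h =>
    calc a = ∫ w in V, M w * a := by rw [integral_mul_const, hMnorm, one_mul]
      _ ≤ I t x := setIntegral_mono_on (hMi.mul_const a) (hMgi t x) hVm
          fun w hw => mul_le_mul_of_nonneg_left (h w hw) (hMnn w hw)
  have hI_le : ∀ t x a, (∀ w ∈ V, g t x w ≤ a) → I t x ≤ a := fun t x a h =>
    calc I t x ≤ ∫ w in V, M w * a := setIntegral_mono_on (hMgi t x) (hMi.mul_const a) hVm
          fun w hw => mul_le_mul_of_nonneg_left (h w hw) (hMnn w hw)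
      _ = a := by rw [integral_mul_const, hMnorm, one_mul]
  have hgcont : ∀ x v, Continuous (fun s : ℝ => g s (x + s • v) v) := fun x v => by
    have := hψC1.continuous
    fun_prop
  have hgderiv : ∀ s ∈ Set.Ioo 0 T, ∀ x, ∀ v ∈ V,
      HasDerivAt (fun s : ℝ => g s (x + s • v) v) (G s (x + s • v) v) s := by
    intro s hs x v hv
    have hpath : HasDerivAt (fun s : ℝ => (s, x + s • v, v)) (1, v, 0) s := by
      refine (hasDerivAt_id s).prodMk (HasDerivAt.prodMk ?_ (hasDerivAt_const s v))
      simpa using ((hasDerivAt_id s).smul_const v).const_add x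
    have hψ : HasDerivAt (fun s : ℝ => ψ (s, x + s • v, v)) _ s :=
      ((hψC1.differentiable one_ne_zero) (s, x + s • v, v)).hasFDerivAt.comp_hasDerivAt s hpath
    rw [heq s _ v hs hv] at hψ
    refine (hψ.neg.div_const ε).exp.congr_deriv ?_
    have hinv : Real.exp (-ψ (s, x + s • v, v) / ε) * Real.exp (ψ (s, x + s • v, v) / ε) = 1 := by
      rw [← Real.exp_add, neg_div, neg_add_cancel, Real.exp_zero]
    simp only [G, I, g, Pi.neg_apply]
    linear_combination ((1 + r) * (∫ w in V, M w * Real.exp (-ψ (s, x + s • v, w) / ε)) / ε) * hinv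
  have hgle : ∀ t x v, g t x v ≤ Real.exp (B / ε) := fun t x v =>
    Real.exp_le_exp.2 (div_le_div_of_nonneg_right (neg_le.1 (abs_le.1 (hB _)).1) hε.le)
  intro t x v ht hv
  constructor
  · have h := nonneg_of_transport_lower_bound (V := V) (T := T) (K := Real.exp (B / ε))
      (inv_pos.2 hε) (fun t x v => 1 - g t x v) (fun t x v => -G t x v)
      (fun s x v => by linarith [hgle s x v])
      (fun x v _ => (continuous_const.sub (hgcont x v)).continuousOn)
      (fun s hs x v hv => (hgderiv s hs x v hv).const_sub 1)
      (fun s _ x v _ b hb hneg => by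
        have h1 := hI_le s x (1 + b) fun w hw => by linarith [hb w hw]
        have h2 := mul_nonneg hr (hI0 s x)
        rw [← neg_div, inv_mul_eq_div, ← neg_div]
        refine div_le_div_of_nonneg_right ?_ hε.le
        nlinarith [mul_nonneg h2 (sub_nonneg.2 (sub_neg.1 hneg).le)])
      (fun x v hv => sub_nonneg.2 (Real.exp_le_one_iff.2
        (div_nonpos_of_nonpos_of_nonneg (neg_nonpos.2 (hinit x v hv).1) hε.le))) t ht x v hv
    have h' := Real.exp_le_one_iff.1 (sub_nonneg.1 h)
    rw [div_le_iff₀ hε] at h'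
    linarith
  · have hc1 : Real.exp (-C / ε) ≤ 1 :=
      Real.exp_le_one_iff.2 (div_nonpos_of_nonpos_of_nonneg (neg_nonpos.2 hC) hε.le)
    have h := nonneg_of_transport_lower_bound (V := V) (T := T) (K := Real.exp (-C / ε))
      (inv_pos.2 hε) (fun t x v => g t x v - Real.exp (-C / ε)) G
      (fun s x v => by linarith [hgpos s x v])
      (fun x v _ => ((hgcont x v).sub continuous_const).continuousOn)
      (fun s hs x v hv => (hgderiv s hs x v hv).sub_const _)
      (fun s _ x v _ b hb hneg => by
        have h1 := hI_ge s x (Real.exp (-C / ε) - b) fun w hw => by linarith [hb w hw]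
        have h2 := mul_nonneg hr (hI0 s x)
        rw [inv_mul_eq_div, ← neg_div]
        refine div_le_div_of_nonneg_right ?_ hε.le
        nlinarith [mul_nonneg h2 (sub_nonneg.2 (sub_neg.1 hneg).le),
          mul_nonneg h2 (sub_nonneg.2 hc1)])
      (fun x v hv => sub_nonneg.2 (Real.exp_le_exp.2
        (div_le_div_of_nonneg_right (neg_le_neg (hinit x v hv).2) hε.le))) t ht x v hv
    have h' := Real.exp_le_exp.1 (sub_nonneg.1 h)
    rw [div_le_div_iff_of_pos_right hε] at h'
    linarith
end
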